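/- arXiv:1911.01588 — 5 statements merged into one kernel-verified Lean document; each statement's English description precedes it below -/
import Mathlib

section
/- Let n ≥ 1, let f : (Fin n → Bool) → Bool be a feedback function, let F_f be the associated Fibonacci transition map, and let x₀ : Fin n → Bool be any initial state. Then for every time t : ℕ and every index i : Fin n, the state at time t is the length-n window of the output sequence starting at t: (F_f^[t] x₀) i = outF f x₀ (t + i). -/
/-- The Fibonacci transition map `F_f` of an `n`-stage FSR with feedback function `f`:
`(F_f x) i = x (i+1)` when `(i : ℕ) + 1 < n`, and `(F_f x) i = f x` when `(i : ℕ) + 1 = n`. -/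
def fibStep (n : ℕ) (f : (Fin n → Bool) → Bool) (x : Fin n → Bool) : Fin n → Bool :=
  fun i => if h : (i : ℕ) + 1 < n then x ⟨(i : ℕ) + 1, h⟩ else f x

/-- The output sequence of the `n`-stage Fibonacci FSR with feedback `f` from initial state `x₀`. -/
def outF (n : ℕ) (hn : 0 < n) (f : (Fin n → Bool) → Bool) (x₀ : Fin n → Bool) (t : ℕ) : Bool :=
  (fibStep n f)^[t] x₀ ⟨0, hn⟩

/-- The output sequence of an `n`-stage (Galois) FSR with transition map `G` from initial state `z₀`. -/
def outG (n : ℕ) (hn : 0 < n) (G : (Fin n → Bool) → (Fin n → Bool)) (z₀ : Fin n → Bool) (t : ℕ) : Bool :=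
  (G^[t] z₀) ⟨0, hn⟩

/-- The state at time `t` is the length-`n` window of the output sequence starting at `t`. -/
theorem fibonacci_state_is_output_window (n : ℕ) (hn : 1 ≤ n)
    (f : (Fin n → Bool) → Bool) (x₀ : Fin n → Bool) (t : ℕ) (i : Fin n) :
    (fibStep n f)^[t] x₀ i = outF n hn f x₀ (t + (i : ℕ)) := by
  obtain ⟨k, hk⟩ := i
  induction k generalizing t with
  | zero => rfl
  | succ k ih =>
    have h := ih (t + 1) (by omega)
    rw [Function.iterate_succ_apply'] at h
    simpa [fibStep, hk, add_assoc, add_comm 1 k] using h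
end

section
/- (Lemma 2 of the paper.) Let n ≥ 1, let f : (Fin n → Bool) → Bool be a feedback function with Fibonacci transition map F_f, let G : (Fin n → Bool) → (Fin n → Bool) be a Galois FSR transition map, and let T : (Fin n → Bool) → (Fin n → Bool) be a state correspondence such that for every initial state x₀ the Galois FSR started from T x₀ produces the same output sequence as the Fibonacci FSR started from x₀, i.e. outG G (T x₀) = outF f x₀ for all x₀. Then T is a bijection of the state space (in matrix terms: the coordinate-transformation matrix is nonsingular). -/
/-- As long as the reading position stays inside the register, iterating the Fibonacci
transition map shifts the state. -/
theorem fibStep_iterate_apply (n : ℕ) (f : (Fin n → Bool) → Bool) (t : ℕ) (x : Fin n → Bool)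
    (i : ℕ) (h : i + t < n) :
    (fibStep n f)^[t] x ⟨i, by omega⟩ = x ⟨i + t, h⟩ := by
  induction t generalizing x with
  | zero => rfl
  | succ t ih =>
    rw [Function.iterate_succ_apply, ih (fibStep n f x) (by omega)]
    exact dif_pos h

/-- The first `n` output bits of an `n`-stage Fibonacci FSR are its initial state. -/
theorem outF_apply_val (n : ℕ) (hn : 0 < n) (f : (Fin n → Bool) → Bool) (x : Fin n → Bool)
    (i : Fin n) : outF n hn f x i = x i := by
  simpa [outF] using fibStep_iterate_apply n f i x 0 (by simp)

/-- Distinct initial states of a Fibonacci FSR generate distinct output sequences. -/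
theorem outF_injective (n : ℕ) (hn : 0 < n) (f : (Fin n → Bool) → Bool) :
    Function.Injective (outF n hn f) := by
  intro x y hxy
  funext i
  rw [← outF_apply_val n hn f x i, hxy, outF_apply_val]

/-- Lemma 2: if a state correspondence `T` carries each initial state of a Fibonacci FSR to an
initial state of a Galois FSR generating the same output sequence, then `T` is a bijection
(the coordinate-transformation matrix is nonsingular). -/
theorem coordinate_transformation_nonsingular (n : ℕ) (hn : 1 ≤ n)
    (f : (Fin n → Bool) → Bool) (G : (Fin n → Bool) → (Fin n → Bool))
    (T : (Fin n → Bool) → (Fin n → Bool))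
    (hT : ∀ x₀ : Fin n → Bool, outG n hn G (T x₀) = outF n hn f x₀) :
    Function.Bijective T := by
  refine Function.Injective.bijective_of_finite fun x y hxy => outF_injective n hn f ?_
  rw [← hT x, ← hT y, hxy]
end

section
/- (Completeness part of Theorem 1 of the paper.) Let n ≥ 1, let f : (Fin n → Bool) → Bool be a feedback function with Fibonacci transition map F_f, and let G : (Fin n → Bool) → (Fin n → Bool) be an n-stage Galois FSR transition map whose set of output sequences equals that of the Fibonacci FSR: Set.range (outG G) = Set.range (outF f). Then there exists a bijection P : (Fin n → Bool) ≃ (Fin n → Bool) preserving the output bit, (P x) ⟨0⟩ = x ⟨0⟩ for all x, such that G ∘ P = P ∘ F_f (i.e. G is obtained from F_f by an output-preserving coordinate transformation). -/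
theorem iterate_fibStep_apply (n : ℕ) (f : (Fin n → Bool) → Bool) (t : ℕ) (x : Fin n → Bool)
    (i : Fin n) (h : (i : ℕ) + t < n) : (fibStep n f)^[t] x i = x ⟨(i : ℕ) + t, h⟩ := by
  induction t generalizing i with
  | zero => rfl
  | succ t ih =>
    have hi : (i : ℕ) + 1 < n := by omega
    rw [Function.iterate_succ_apply', fibStep, dite_cond_eq_true (eq_true hi),
      ih ⟨(i : ℕ) + 1, hi⟩ (by simp only; omega)]
    congr 2
    simp only
    omega

theorem outG_injective_of_range_eq (n : ℕ) (hn : 0 < n)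
    (f : (Fin n → Bool) → Bool) (G : (Fin n → Bool) → (Fin n → Bool))
    (hequiv : Set.range (outG n hn G) = Set.range (outF n hn f)) :
    Function.Injective (outG n hn G) := by
  have hex (z : Fin n → Bool) : ∃ x, outF n hn f x = outG n hn G z := by
    rw [← Set.mem_range, ← hequiv]
    exact Set.mem_range_self z
  choose Q hQ using hex
  have hsurj : Function.Surjective Q := by
    intro x
    obtain ⟨z, hz⟩ : outF n hn f x ∈ Set.range (outG n hn G) := hequiv ▸ Set.mem_range_self x
    exact ⟨z, outF_injective n hn f ((hQ z).trans hz)⟩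
  intro z w hzw
  refine Finite.injective_iff_surjective.mpr hsurj (outF_injective n hn f ?_)
  rw [hQ, hQ, hzw]

/-- Completeness part of Theorem 1: an `n`-stage Galois FSR equivalent to an `n`-stage Fibonacci
FSR is obtained from it by an output-bit-preserving coordinate transformation. -/
theorem equivalent_galois_is_conjugate (n : ℕ) (hn : 1 ≤ n)
    (f : (Fin n → Bool) → Bool) (G : (Fin n → Bool) → (Fin n → Bool))
    (hequiv : Set.range (outG n hn G) = Set.range (outF n hn f)) :
    ∃ P : (Fin n → Bool) ≃ (Fin n → Bool),
      (∀ x : Fin n → Bool, P x ⟨0, hn⟩ = x ⟨0, hn⟩) ∧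
      G ∘ ⇑P = ⇑P ∘ fibStep n f := by
  have hGinj := outG_injective_of_range_eq n hn f G hequiv
  have hex (x : Fin n → Bool) : ∃ z, outG n hn G z = outF n hn f x := by
    rw [← Set.mem_range, hequiv]
    exact Set.mem_range_self x
  choose P hP using hex
  have hPinj : Function.Injective P := by
    intro x y hxy
    apply outF_injective n hn f
    rw [← hP, ← hP, hxy]
  refine ⟨Equiv.ofBijective P (Finite.injective_iff_bijective.mp hPinj),
    fun x => congrFun (hP x) 0, ?_⟩
  funext x
  apply hGinj
  funext t
  exact (congrFun (hP x) (t + 1)).trans (congrFun (hP (fibStep n f x)) t).symm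
end

section
/- (Galois half of Lemma 4 of the paper.) Let s : ℕ → Bool be an ultimately periodic binary sequence: there exist p > 0 and N : ℕ such that s (t + p) = s t for all t ≥ N. Then for every n ≥ 1 with N + p ≤ 2^(n-1) there exist a Galois FSR transition map G : (Fin n → Bool) → (Fin n → Bool) and an initial state z₀ such that the output sequence of G from z₀ equals s, i.e. outG G z₀ t = s t for all t. -/
/-- Every machine on a finite set of at most `2 ^ (n - 1)` states with a binary output function is
simulated by an `n`-stage Galois FSR: stage `0` holds the output, the others encode the state. -/
theorem exists_outG_eq_of_card_le {α : Type*} [Fintype α] (next : α → α) (out : α → Bool) (a₀ : α)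
    (n : ℕ) (hn : 0 < n) (hcard : Fintype.card α ≤ 2 ^ (n - 1)) :
    ∃ (G : (Fin n → Bool) → (Fin n → Bool)) (z₀ : Fin n → Bool),
      ∀ t : ℕ, outG n hn G z₀ t = out (next^[t] a₀) := by
  obtain ⟨m, rfl⟩ : ∃ m, n = m + 1 := ⟨n - 1, by omega⟩
  obtain ⟨e⟩ : Nonempty (α ↪ (Fin m → Bool)) :=
    Function.Embedding.nonempty_of_card_le (by simpa using hcard)
  have : Nonempty α := ⟨a₀⟩
  let enc : α → (Fin (m + 1) → Bool) := fun a => Fin.cons (out a) (e a)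
  have henc : Function.Injective enc := fun a b h => e.injective (Fin.cons_injective2 h).2
  let G : (Fin (m + 1) → Bool) → (Fin (m + 1) → Bool) :=
    fun z => enc (next (Function.invFun enc z))
  have hsemi : Function.Semiconj enc next G := fun a => by
    simp only [G, Function.leftInverse_invFun henc a]
  refine ⟨G, enc a₀, fun t => ?_⟩
  rw [outG, ← (hsemi.iterate_right t).eq a₀]
  rfl

/-- The cyclic counter on `N + p` states that steps from the last state back to `N`. -/
def rhoStep (N p : ℕ) (hp : 0 < p) (i : Fin (N + p)) : Fin (N + p) :=
  if h : (i : ℕ) + 1 < N + p then ⟨i + 1, h⟩ else ⟨N, by omega⟩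

theorem apply_rhoStep_iterate_add (s : ℕ → Bool) (p N : ℕ) (hp : 0 < p)
    (hper : ∀ t : ℕ, N ≤ t → s (t + p) = s t) (t k : ℕ) :
    s (((rhoStep N p hp)^[t] ⟨0, by omega⟩ : Fin (N + p)) + k) = s (t + k) := by
  induction t generalizing k with
  | zero => simp
  | succ t ih =>
    rw [Function.iterate_succ_apply', show t + 1 + k = t + (1 + k) by ring, ← ih (1 + k)]
    generalize (rhoStep N p hp)^[t] ⟨0, by omega⟩ = i
    unfold rhoStep
    split_ifs with h
    · exact congrArg s (by simp only; ring)
    · rw [← hper (N + k) (by omega)]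
      exact congrArg s (by omega)

/-- Galois half of Lemma 4: every ultimately periodic binary sequence with preperiod `N` and a
period `p` is generated by some `n`-stage Galois FSR whenever `N + p ≤ 2^(n-1)`. -/
theorem galois_generates_ultimately_periodic (s : ℕ → Bool) (p N : ℕ) (hp : 0 < p)
    (hper : ∀ t : ℕ, N ≤ t → s (t + p) = s t)
    (n : ℕ) (hn : 1 ≤ n) (hsize : N + p ≤ 2 ^ (n - 1)) :
    ∃ (G : (Fin n → Bool) → (Fin n → Bool)) (z₀ : Fin n → Bool),
      ∀ t : ℕ, outG n hn G z₀ t = s t := by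
  obtain ⟨G, z₀, hG⟩ := exists_outG_eq_of_card_le (rhoStep N p hp) (fun i => s i)
    ⟨0, by omega⟩ n hn (by simpa using hsize)
  exact ⟨G, z₀, fun t => (hG t).trans (apply_rhoStep_iterate_add s p N hp hper t 0)⟩
end

section
/- (Fibonacci half of Lemma 4 of the paper.) There exist n ≥ 1 and an ultimately periodic binary sequence s : ℕ → Bool (for instance n = 3 and s with s 3 = false and s t = true for all t ≠ 3) such that s is the output sequence of some n-stage Galois FSR (there exist G : (Fin n → Bool) → (Fin n → Bool) and z₀ with outG G z₀ = s), yet s is not the output sequence of any n-stage Fibonacci FSR: for every feedback function f : (Fin n → Bool) → Bool and every initial state x₀, outF f x₀ ≠ s. -/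
/-- Fibonacci half of Lemma 4: some ultimately periodic binary sequence is the output sequence of
an `n`-stage Galois FSR but of no `n`-stage Fibonacci FSR. -/
theorem galois_output_not_fibonacci_output :
    ∃ (n : ℕ) (hn : 1 ≤ n) (s : ℕ → Bool),
      (∃ p N : ℕ, 0 < p ∧ ∀ t : ℕ, N ≤ t → s (t + p) = s t) ∧
      (∃ (G : (Fin n → Bool) → (Fin n → Bool)) (z₀ : Fin n → Bool), outG n hn G z₀ = s) ∧
      (∀ (f : (Fin n → Bool) → Bool) (x₀ : Fin n → Bool), outF n hn f x₀ ≠ s) := by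
  refine ⟨2, by norm_num, fun t => decide (t = 0 ∨ t = 2), ⟨1, 3, by norm_num, ?_⟩,
    ⟨fun x => ![!x 0 && x 1, x 0 ^^ x 1], ![true, false], ?_⟩, ?_⟩
  · intro t ht
    simp only [decide_eq_decide]
    omega
  · set G : (Fin 2 → Bool) → (Fin 2 → Bool) := fun x => ![!x 0 && x 1, x 0 ^^ x 1] with hG
    have hfix : G ![false, false] = ![false, false] := by decide
    have hreach : G^[3] ![true, false] = ![false, false] := by decide
    funext t
    match t with
    | 0 => decide
    | 1 => decide
    | 2 => decide
    | t + 3 =>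
      simp only [outG, Function.iterate_add_apply, hreach, Function.iterate_fixed hfix]
      simp
  · intro f x₀ h
    have hshift : ∀ t, (fibStep 2 f)^[t] x₀ =
        ![outF 2 (by norm_num) f x₀ t, outF 2 (by norm_num) f x₀ (t + 1)] := by
      intro t
      funext i
      fin_cases i
      · rfl
      · simp [outF, Function.iterate_succ_apply', fibStep]
    have hfeed : ∀ t, outF 2 (by norm_num) f x₀ (t + 2) =
        f ![outF 2 (by norm_num) f x₀ t, outF 2 (by norm_num) f x₀ (t + 1)] := by
      intro t
      rw [← hshift t]
      simp [outF, Function.iterate_succ_apply', fibStep]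
    have h₀ := hfeed 0
    have h₂ := hfeed 2
    rw [h] at h₀ h₂
    simp at h₀ h₂
    exact Bool.false_ne_true (h₂.symm.trans h₀)
end
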